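/- Let μ, ν ∈ ℝ with μ + ν > −1 and μ − ν an even nonnegative integer, let n ≥ 0, and let φ_n be the monic orthogonal polynomial of degree n for the weight w_{μ,ν}. Then P(x) := (−1)^n φ_n(−x²) is a monic polynomial of degree 2n which is orthogonal with respect to x^μ J_ν(x) on (0,∞), and conversely every monic polynomial of degree 2n that is orthogonal with respect to x^μ J_ν(x) on (0,∞) equals P. -/

import Mathlib

open MeasureTheory Filter Set Polynomial
open scoped Classical

noncomputable section

/-- The Abel limit of `∫₀^∞ g(x) dx` is `L`: for every `s > 0` the integral
`∫₀^∞ e^{-s x} g(x) dx` converges and these integrals tend to `L` as `s → 0⁺`. -/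
def HasAbelLimit (g : ℝ → ℂ) (L : ℂ) : Prop :=
  (∀ s : ℝ, 0 < s →
    IntegrableOn (fun x : ℝ => Complex.exp (-(s : ℂ) * (x : ℂ)) * g x) (Set.Ioi 0)) ∧
  Tendsto (fun s : ℝ => ∫ x in Set.Ioi (0:ℝ), Complex.exp (-(s : ℂ) * (x : ℂ)) * g x)
    (nhdsWithin 0 (Set.Ioi 0)) (nhds L)

/-- Bessel function of the first kind of order `ν`, for `x > 0`, with the convention
`1/Γ(z) = 0` at nonpositive integers `z` (automatic since `Real.Gamma` vanishes there). -/
def besselJ (ν x : ℝ) : ℝ :=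
  ∑' k : ℕ, ((-1 : ℝ) ^ k / ((k.factorial : ℝ) * Real.Gamma (ν + k + 1))) *
    (x / 2) ^ (ν + 2 * (k : ℝ))

/-- Modified Bessel function of the second kind of order `ν`, for `x > 0`. -/
def besselK (ν x : ℝ) : ℝ :=
  ∫ t in Set.Ioi (0:ℝ), Real.exp (-x * Real.cosh t) * Real.cosh (ν * t)

/-- The weight function `w_{μ,ν}` on `(0,∞)`. -/
def weightW (μ ν : ℝ) (x : ℝ) : ℝ :=
  if ∃ m : ℤ, μ - ν = 2 * m then (1/2) * x ^ ((μ - 1)/2) * besselK ν (Real.sqrt x)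
  else (1/2) * x ^ (μ/2) * besselK ν (Real.sqrt x)

/-- `0 < x_1 < ⋯ < x_n` together with positive weights `w_1, …, w_n` form an `n`-point
Gaussian quadrature rule for `w_{μ,ν}`. -/
def IsGaussRule (μ ν : ℝ) (n : ℕ) (xs ws : Fin n → ℝ) : Prop :=
  StrictMono xs ∧ (∀ j, 0 < xs j) ∧ (∀ j, 0 < ws j) ∧
  ∀ p : Polynomial ℝ, p.natDegree ≤ 2 * n - 1 →
    ∑ j, ws j * p.eval (xs j) = ∫ x in Set.Ioi (0:ℝ), weightW μ ν x * p.eval x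

/-- `κ = μ` if `μ - ν` is even and `κ = μ + 1` if `μ - ν` is odd. -/
def kappaQ (μ ν : ℕ) : ℝ := if Even (μ - ν) then (μ : ℝ) else (μ : ℝ) + 1

/-- The boundary weights `ŵ_k⁰` of the generalized Gauss–Radau rule. -/
def wHat0 (μ ν : ℕ) {n : ℕ} (xs ws : Fin n → ℝ) (k : ℕ) : ℝ :=
  (1 / (k.factorial : ℝ)) *
    (2 ^ k * Real.Gamma (((ν : ℝ) + k + 1)/2) / Real.Gamma (((ν : ℝ) - k + 1)/2)
      - (2 / Real.pi) * Real.cos (((k : ℝ) - ν) * Real.pi / 2) *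
          ∑ j, ws j * (xs j) ^ (((k : ℝ) - kappaQ μ ν)/2))

/-- The generalized Gauss–Radau rule `(Q_{2n,μ} f)(ω)`. -/
def QRule (μ ν : ℕ) {n : ℕ} (xs ws : Fin n → ℝ) (f : ℂ → ℂ) (ω : ℝ) : ℂ :=
  (1 / (ω : ℂ)) *
    ((∑ k ∈ Finset.range μ, (wHat0 μ ν xs ws k : ℂ) / (ω : ℂ) ^ k * iteratedDeriv k f 0)
      + ∑ j, ((ws j * (xs j) ^ (-(kappaQ μ ν)/2) / Real.pi : ℝ) : ℂ) *
          (Complex.exp (-(ν : ℂ) * (Real.pi : ℂ) * Complex.I / 2) *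
              f (Complex.I * (Real.sqrt (xs j) : ℂ) / (ω : ℂ))
            + Complex.exp ((ν : ℂ) * (Real.pi : ℂ) * Complex.I / 2) *
              f (-Complex.I * (Real.sqrt (xs j) : ℂ) / (ω : ℂ))))

/-- `P` is a monic polynomial of degree `m` orthogonal with respect to `x^μ J_ν(x)`
on `(0,∞)`, all integrals taken in the Abel-limit sense. -/
def MonicOrthoBessel (μ ν : ℝ) (m : ℕ) (P : Polynomial ℂ) : Prop :=
  P.Monic ∧ P.natDegree = m ∧
  ∀ k < m, HasAbelLimit
    (fun x : ℝ => P.eval (x : ℂ) * ((x ^ ((k : ℝ) + μ) : ℝ) : ℂ) * (besselJ ν x : ℂ)) 0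

/-- `φ` is the monic real polynomial of degree `m` orthogonal to all lower powers
with respect to the weight `w_{μ,ν}` on `(0,∞)`. -/
def IsMonicOrthoW (μ ν : ℝ) (m : ℕ) (φ : Polynomial ℝ) : Prop :=
  φ.Monic ∧ φ.natDegree = m ∧
  ∀ k < m, ∫ x in Set.Ioi (0:ℝ), weightW μ ν x * φ.eval x * x ^ k = 0


/-- Taylor coefficients of `x ↦ x^{-ν} J_ν(x)` in powers of `x²`. -/
def reducedBesselCoeff (ν : ℝ) (k : ℕ) : ℝ :=
  (-1 : ℝ) ^ k / ((k.factorial : ℝ) * Real.Gamma (ν + k + 1)) * 2 ^ (-(ν + 2 * (k : ℝ)))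

/-- The entire function `x ↦ x^{-ν} J_ν(x)`. -/
def reducedBessel (ν x : ℝ) : ℝ := ∑' k : ℕ, reducedBesselCoeff ν k * x ^ (2 * k)

lemma besselJ_eq_rpow_mul_reducedBessel (ν : ℝ) {x : ℝ} (hx : 0 < x) :
    besselJ ν x = x ^ ν * reducedBessel ν x := by
  unfold besselJ reducedBessel
  rw [← tsum_mul_left]
  refine tsum_congr fun k => ?_
  have h : x ^ (ν + 2 * (k : ℝ)) = x ^ ν * x ^ (2 * k) := by
    rw [Real.rpow_add hx, ← Real.rpow_natCast x (2 * k)]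
    push_cast
    rfl
  rw [Real.div_rpow hx.le (by norm_num), h, reducedBesselCoeff, Real.rpow_neg (by norm_num)]
  ring

lemma Real.inv_Gamma_eq_mul_inv_Gamma_add_one (x : ℝ) :
    (Real.Gamma x)⁻¹ = x * (Real.Gamma (x + 1))⁻¹ := by
  rcases eq_or_ne x 0 with rfl | hx
  · simp [Real.Gamma_zero]
  · rw [Real.Gamma_add_one hx, mul_inv, mul_inv_cancel_left₀ hx]

lemma exists_abs_inv_Gamma_le (ν : ℝ) :
    ∃ C, 0 ≤ C ∧ ∀ k : ℕ, |(Real.Gamma (ν + k + 1))⁻¹| ≤ C := by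
  obtain ⟨K, hK⟩ := exists_nat_ge (-ν)
  set r : ℕ → ℝ := fun k => |(Real.Gamma (ν + k + 1))⁻¹| with hr
  have hstep : ∀ k, K ≤ k → r (k + 1) ≤ r k := by
    intro k hk
    have hk' : (K : ℝ) ≤ k := by exact_mod_cast hk
    have h := Real.inv_Gamma_eq_mul_inv_Gamma_add_one (ν + k + 1)
    simp only [hr]
    rw [h, abs_mul]
    push_cast
    rw [show ν + (k + 1) + 1 = ν + k + 1 + 1 by ring]
    refine le_mul_of_one_le_left (abs_nonneg _) ?_
    rw [abs_of_nonneg (by linarith)]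
    linarith
  refine ⟨∑ k ∈ Finset.range (K + 1), r k,
    Finset.sum_nonneg fun _ _ => abs_nonneg _, fun k => ?_⟩
  have hle : ∀ k ≤ K, r k ≤ ∑ k ∈ Finset.range (K + 1), r k := fun k hk =>
    Finset.single_le_sum (f := r) (fun _ _ => abs_nonneg _) (Finset.mem_range.2 (by omega))
  rcases le_total k K with hk | hk
  · exact hle k hk
  · refine le_trans ?_ (hle K le_rfl)
    induction k, hk using Nat.le_induction with
    | base => exact le_rfl
    | succ k hk ih => exact (hstep k hk).trans ih

lemma exists_abs_reducedBesselCoeff_le (ν : ℝ) :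
    ∃ C, 0 ≤ C ∧ ∀ k : ℕ, |reducedBesselCoeff ν k| ≤ C * ((1 / 4) ^ k / (k.factorial : ℝ)) := by
  obtain ⟨C, hC, h⟩ := exists_abs_inv_Gamma_le ν
  refine ⟨C * 2 ^ (-ν), by positivity, fun k => ?_⟩
  have h2 : (2 : ℝ) ^ (-(ν + 2 * (k : ℝ))) = 2 ^ (-ν) * (1 / 4) ^ k := by
    rw [neg_add, Real.rpow_add (by norm_num), ← neg_mul, Real.rpow_mul (by norm_num),
      Real.rpow_natCast]
    norm_num
  have hk : (0 : ℝ) < k.factorial := by positivity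
  have e : reducedBesselCoeff ν k = (-1) ^ k * ((Real.Gamma (ν + k + 1))⁻¹ *
      (2 ^ (-ν) * ((1 / 4) ^ k / (k.factorial : ℝ)))) := by
    rw [reducedBesselCoeff, h2, div_eq_mul_inv, mul_inv]
    ring
  rw [e, abs_mul, abs_pow, abs_neg, abs_one, one_pow, one_mul, abs_mul, mul_assoc]
  rw [abs_of_nonneg (by positivity : (0 : ℝ) ≤ 2 ^ (-ν) * ((1 / 4) ^ k / (k.factorial : ℝ)))]
  gcongr
  exact h k

lemma summable_reducedBesselCoeff_mul (ν x : ℝ) :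
    Summable fun k : ℕ => reducedBesselCoeff ν k * x ^ (2 * k) := by
  obtain ⟨C, hC, h⟩ := exists_abs_reducedBesselCoeff_le ν
  refine Summable.of_norm_bounded (g := fun k : ℕ => C * ((x ^ 2 / 4) ^ k / (k.factorial : ℝ)))
    ((Real.summable_pow_div_factorial _).mul_left C) fun k => ?_
  have hx : (0 : ℝ) ≤ x ^ (2 * k) := by rw [pow_mul]; positivity
  rw [Real.norm_eq_abs, abs_mul, abs_of_nonneg hx]
  calc |reducedBesselCoeff ν k| * x ^ (2 * k)
      ≤ C * ((1 / 4) ^ k / (k.factorial : ℝ)) * x ^ (2 * k) :=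
        mul_le_mul_of_nonneg_right (h k) hx
    _ = C * ((x ^ 2 / 4) ^ k / (k.factorial : ℝ)) := by
        rw [pow_mul, div_pow, div_pow, one_pow]; ring

lemma reducedBesselCoeff_succ (ν : ℝ) (k : ℕ) :
    reducedBesselCoeff ν (k + 1) * (2 * (k + 1)) = -reducedBesselCoeff (ν + 1) k := by
  have h2 : (2 : ℝ) ^ (-(ν + 1 + 2 * (k : ℝ))) = 2 ^ (-(ν + 2 * ((k + 1 : ℕ) : ℝ))) * 2 := by
    rw [← Real.rpow_add_one (by norm_num)]
    congr 1
    push_cast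
    ring
  unfold reducedBesselCoeff
  rw [h2, Nat.factorial_succ, pow_succ, div_eq_mul_inv, div_eq_mul_inv, mul_inv, mul_inv]
  push_cast
  rw [show ν + ((k : ℝ) + 1) + 1 = ν + 1 + k + 1 by ring, mul_inv]
  have hk : ((k : ℝ) + 1) ≠ 0 := by positivity
  field_simp

/-- The derivative of `x^{-ν} J_ν(x)` is `-x · x^{-ν-1} J_{ν+1}(x)`. -/
lemma hasDerivAt_reducedBessel (ν x : ℝ) :
    HasDerivAt (reducedBessel ν) (-x * reducedBessel (ν + 1) x) x := by
  obtain ⟨C, hC, h⟩ := exists_abs_reducedBesselCoeff_le ν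
  set R : ℝ := |x| + 1 with hR
  have hR1 : 1 ≤ R := by simp [hR]
  have key := hasDerivAt_tsum_of_isPreconnected (𝕜 := ℝ) (F := ℝ)
    (u := fun k : ℕ => 2 * C * ((R ^ 2 / 2) ^ k / (k.factorial : ℝ)))
    (t := Metric.ball (0 : ℝ) R)
    (g := fun k y => reducedBesselCoeff ν k * y ^ (2 * k))
    (g' := fun k y => reducedBesselCoeff ν k * (((2 * k : ℕ) : ℝ) * y ^ (2 * k - 1)))
    (y₀ := 0) (y := x)
    ((Real.summable_pow_div_factorial _).mul_left _) Metric.isOpen_ball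
    (convex_ball _ _).isPreconnected
    (fun k y _ => (hasDerivAt_pow (2 * k) y).const_mul _)
    (fun k y hy => ?_) (by simp; positivity) (summable_reducedBesselCoeff_mul ν 0)
    (by simp [hR])
  · unfold reducedBessel
    refine key.congr_deriv ?_
    have hs : Summable fun k : ℕ =>
        reducedBesselCoeff ν k * (((2 * k : ℕ) : ℝ) * x ^ (2 * k - 1)) := by
      rw [← summable_nat_add_iff 1]
      have := (summable_reducedBesselCoeff_mul (ν + 1) x).mul_left (-x)
      refine this.congr fun k => ?_
      have := reducedBesselCoeff_succ ν k
      rw [show 2 * (k + 1) - 1 = 2 * k + 1 by omega, pow_succ]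
      push_cast
      linear_combination -x * x ^ (2 * k) * this
    rw [hs.tsum_eq_zero_add, ← tsum_mul_left]
    simp only [mul_zero, Nat.cast_zero, zero_mul, zero_add]
    refine tsum_congr fun k => ?_
    have := reducedBesselCoeff_succ ν k
    rw [show 2 * (k + 1) - 1 = 2 * k + 1 by omega, pow_succ]
    push_cast
    linear_combination x * x ^ (2 * k) * this
  · have hy' : |y| ≤ R := by simpa using (Metric.mem_ball.1 hy).le
    have h1 : |y| ^ (2 * k - 1) ≤ R ^ (2 * k) :=
      (pow_le_pow_left₀ (abs_nonneg _) hy' _).trans (pow_le_pow_right₀ hR1 (by omega))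
    have h2 : (k : ℝ) ≤ 2 ^ k := by exact_mod_cast Nat.lt_two_pow_self.le
    rw [Real.norm_eq_abs, abs_mul, abs_mul, abs_pow, Nat.abs_cast]
    push_cast
    calc |reducedBesselCoeff ν k| * (2 * (k : ℝ) * |y| ^ (2 * k - 1))
        ≤ C * ((1 / 4) ^ k / (k.factorial : ℝ)) * (2 * 2 ^ k * R ^ (2 * k)) := by
          gcongr
          exact h k
      _ = 2 * C * ((R ^ 2 / 2) ^ k / (k.factorial : ℝ)) := by
          rw [pow_mul, div_pow, div_pow, one_pow, show (4 : ℝ) = 2 * 2 by norm_num, mul_pow]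
          field_simp

lemma continuous_reducedBessel (ν : ℝ) : Continuous (reducedBessel ν) :=
  continuous_iff_continuousAt.2 fun x => (hasDerivAt_reducedBessel ν x).continuousAt

lemma reducedBessel_zero (ν : ℝ) :
    reducedBessel ν 0 = (Real.Gamma (ν + 1))⁻¹ * 2 ^ (-ν) := by
  unfold reducedBessel
  rw [tsum_eq_single 0 (fun k hk => by simp [hk])]
  simp [reducedBesselCoeff]

lemma reducedBessel_recurrence (ν x : ℝ) :
    reducedBessel ν x =
      2 * (ν + 1) * reducedBessel (ν + 1) x - x ^ 2 * reducedBessel (ν + 2) x := by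
  have hs0 := summable_reducedBesselCoeff_mul ν x
  have hs1 := (summable_reducedBesselCoeff_mul (ν + 1) x).mul_left (2 * (ν + 1))
  have h0 : reducedBesselCoeff ν 0 = 2 * (ν + 1) * reducedBesselCoeff (ν + 1) 0 := by
    simp only [reducedBesselCoeff, pow_zero, Nat.factorial_zero, Nat.cast_one, Nat.cast_zero,
      add_zero, one_mul, mul_zero, one_div]
    rw [Real.inv_Gamma_eq_mul_inv_Gamma_add_one (ν + 1),
      show -ν = -(ν + 1) + 1 by ring, Real.rpow_add_one (by norm_num)]
    ring
  have hstep : ∀ k, reducedBesselCoeff ν (k + 1) =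
      2 * (ν + 1) * reducedBesselCoeff (ν + 1) (k + 1) - reducedBesselCoeff (ν + 2) k := by
    intro k
    have hk : ((k : ℝ) + 1) ≠ 0 := by positivity
    have hfac : (k.factorial : ℝ) ≠ 0 := by positivity
    have e1 : (2 : ℝ) ^ (-(ν + 2 * ((k + 1 : ℕ) : ℝ))) =
        2 ^ (-(ν + 1 + 2 * ((k + 1 : ℕ) : ℝ))) * 2 := by
      rw [← Real.rpow_add_one (by norm_num)]; congr 1; ring
    have e2 : (2 : ℝ) ^ (-(ν + 2 + 2 * (k : ℝ))) =
        2 ^ (-(ν + 1 + 2 * ((k + 1 : ℕ) : ℝ))) * 2 := by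
      rw [← Real.rpow_add_one (by norm_num)]; congr 1; push_cast; ring
    have e3 := Real.inv_Gamma_eq_mul_inv_Gamma_add_one (ν + k + 2)
    unfold reducedBesselCoeff
    rw [e1, e2, Nat.factorial_succ, pow_succ, div_eq_mul_inv, div_eq_mul_inv, div_eq_mul_inv,
      mul_inv, mul_inv, mul_inv]
    push_cast
    rw [show ν + ((k : ℝ) + 1) + 1 = ν + k + 2 by ring,
      show ν + 1 + ((k : ℝ) + 1) + 1 = ν + k + 2 + 1 by ring,
      show ν + 2 + (k : ℝ) + 1 = ν + k + 2 + 1 by ring, e3, mul_inv]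
    field_simp
    ring
  have hs2 := (summable_reducedBesselCoeff_mul (ν + 2) x).mul_left (x ^ 2)
  unfold reducedBessel
  rw [← tsum_mul_left, ← tsum_mul_left, hs0.tsum_eq_zero_add, hs1.tsum_eq_zero_add,
    add_sub_assoc, ← ((summable_nat_add_iff 1).2 hs1).tsum_sub hs2, h0]
  congr 1
  · ring
  · refine tsum_congr fun k => ?_
    rw [hstep]
    ring

lemma hasDerivAt_reducedBessel_succ (ν : ℝ) {x : ℝ} (hx : x ≠ 0) :
    HasDerivAt (reducedBessel (ν + 1))
      ((reducedBessel ν x - 2 * (ν + 1) * reducedBessel (ν + 1) x) / x) x := by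
  refine (hasDerivAt_reducedBessel (ν + 1) x).congr_deriv ?_
  rw [reducedBessel_recurrence ν x, show ν + 1 + 1 = ν + 2 by ring]
  field_simp
  ring

/-- For `ν ≥ -1/2`, monotonicity of the energy `h_ν² + x² h_{ν+1}²` bounds `h_ν = x^{-ν} J_ν`. -/
lemma abs_reducedBessel_le {ν : ℝ} (hν : -1 / 2 ≤ ν) {x : ℝ} (hx : 0 ≤ x) :
    |reducedBessel ν x| ≤ |reducedBessel ν 0| := by
  set E : ℝ → ℝ := fun y => reducedBessel ν y ^ 2 + y ^ 2 * reducedBessel (ν + 1) y ^ 2 with hE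
  have hd : ∀ y, 0 < y → HasDerivAt E (-((4 * ν + 2) * y * reducedBessel (ν + 1) y ^ 2)) y := by
    intro y hy
    have h := ((hasDerivAt_reducedBessel ν y).pow 2).add
      ((hasDerivAt_pow 2 y).mul ((hasDerivAt_reducedBessel_succ ν hy.ne').pow 2))
    refine h.congr_deriv ?_
    simp only [Pi.pow_apply]
    push_cast
    field_simp
    ring
  have hanti : AntitoneOn E (Set.Ici 0) := by
    refine antitoneOn_of_deriv_nonpos (convex_Ici 0) ?_ ?_ ?_
    · have h0 := continuous_reducedBessel ν
      have h1 := continuous_reducedBessel (ν + 1)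
      exact Continuous.continuousOn (by fun_prop)
    · rw [interior_Ici]
      exact fun y hy => (hd y hy).differentiableAt.differentiableWithinAt
    · rw [interior_Ici]
      intro y hy
      rw [(hd y hy).deriv]
      have : 0 ≤ (4 * ν + 2) * y := mul_nonneg (by linarith) (le_of_lt hy)
      have := mul_nonneg this (sq_nonneg (reducedBessel (ν + 1) y))
      linarith
  have h := hanti (Set.mem_Ici.2 le_rfl) (Set.mem_Ici.2 hx) hx
  simp only [hE] at h
  refine sq_le_sq.1 ?_
  nlinarith [mul_nonneg (sq_nonneg x) (sq_nonneg (reducedBessel (ν + 1) x))]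

lemma integrableOn_exp_neg_mul_rpow {s α : ℝ} (hs : 0 < s) (hα : -1 < α) :
    IntegrableOn (fun x : ℝ => Real.exp (-s * x) * x ^ α) (Set.Ioi 0) := by
  refine (integrableOn_rpow_mul_exp_neg_mul_rpow hα one_pos hs).congr_fun (fun x _ => ?_)
    measurableSet_Ioi
  simp only [Real.rpow_one]
  ring

lemma integrableOn_exp_neg_mul_reducedBessel (ν : ℝ) {s α : ℝ} (hs : 0 < s) (hα : -1 < α) :
    IntegrableOn (fun x : ℝ => Real.exp (-s * x) * (x ^ α * reducedBessel ν x)) (Set.Ioi 0) := by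
  obtain ⟨M, hM⟩ := exists_nat_ge (-1 / 2 - ν)
  induction M using Nat.strong_induction_on generalizing ν α with
  | _ M ih =>
  rcases le_or_gt (-1 / 2) ν with hν | hν
  · have hb := integrableOn_exp_neg_mul_rpow hs hα
    have := hb.mul_bdd (g := reducedBessel ν) (c := |reducedBessel ν 0|)
      (continuous_reducedBessel ν).aestronglyMeasurable
      (by
        filter_upwards [ae_restrict_mem measurableSet_Ioi] with x hx
        exact abs_reducedBessel_le hν (le_of_lt hx))
    refine this.congr (Eventually.of_forall fun x => ?_)
    simp only [mul_assoc]
  · have hM0 : 0 < M := by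
      rcases Nat.eq_zero_or_pos M with rfl | h
      · norm_num at hM; linarith
      · exact h
    have hcast : ((M - 1 : ℕ) : ℝ) = M - 1 := by push_cast [Nat.cast_sub hM0]; ring
    have i1 := (ih (M - 1) (by omega) (ν + 1) hα (by rw [hcast]; linarith)).const_mul
      (2 * (ν + 1))
    have i2 := ih (M - 1) (by omega) (ν + 2) (α := α + 2) (by linarith) (by rw [hcast]; linarith)
    refine IntegrableOn.congr_fun (i1.sub i2) (fun x hx => ?_) measurableSet_Ioi
    have hx : 0 < x := hx
    simp only [Pi.sub_apply]
    rw [reducedBessel_recurrence ν x, Real.rpow_add hx, Real.rpow_two]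
    ring

/-- The Laplace transform of `x^α · x^{-ν} J_ν(x)`. -/
def besselLaplace (ν α s : ℝ) : ℝ :=
  ∫ x in Set.Ioi (0 : ℝ), Real.exp (-s * x) * (x ^ α * reducedBessel ν x)

lemma hasDerivAt_exp_mul_rpow_mul {f : ℝ → ℝ} {f' s β x : ℝ} (hx : 0 < x)
    (hf : HasDerivAt f f' x) :
    HasDerivAt (fun y => Real.exp (-s * y) * (y ^ β * f y))
      (-s * (Real.exp (-s * x) * (x ^ β * f x)) + β * (Real.exp (-s * x) * (x ^ (β - 1) * f x))
        + Real.exp (-s * x) * (x ^ β * f')) x := by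
  have h1 : HasDerivAt (fun y : ℝ => Real.exp (-s * y)) (Real.exp (-s * x) * (-s * 1)) x :=
    ((hasDerivAt_id x).const_mul (-s)).exp
  refine (h1.mul ((Real.hasDerivAt_rpow_const (p := β) (Or.inl hx.ne')).mul hf)).congr_deriv ?_
  simp only [Pi.mul_apply]
  ring

lemma integral_deriv_exp_mul_rpow_mul_reducedBessel (ν : ℝ) {s β : ℝ} (hs : 0 < s) (hβ : 0 < β)
    {g : ℝ → ℝ} (hg : IntegrableOn g (Set.Ioi 0))
    (hd : ∀ x ∈ Set.Ioi (0 : ℝ),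
      HasDerivAt (fun y => Real.exp (-s * y) * (y ^ β * reducedBessel ν y)) (g x) x) :
    ∫ x in Set.Ioi (0 : ℝ), g x = 0 := by
  have hc : Continuous (fun y : ℝ => Real.exp (-s * y) * (y ^ β * reducedBessel ν y)) := by
    have h1 := continuous_reducedBessel ν
    have h2 : Continuous fun y : ℝ => y ^ β := Real.continuous_rpow_const hβ.le
    fun_prop
  rw [integral_Ioi_of_hasDerivAt_of_tendsto hc.continuousWithinAt hd hg
    (tendsto_zero_of_hasDerivAt_of_integrableOn_Ioi hd hg
      (integrableOn_exp_neg_mul_reducedBessel ν hs (by linarith)))]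
  simp [Real.zero_rpow hβ.ne']

lemma besselLaplace_succ_succ (ν : ℝ) {s β : ℝ} (hs : 0 < s) (hβ : 0 < β) :
    besselLaplace (ν + 1) (β + 1) s =
      β * besselLaplace ν (β - 1) s - s * besselLaplace ν β s := by
  have i1 := (integrableOn_exp_neg_mul_reducedBessel ν hs (α := β) (by linarith)).const_mul (-s)
  have i2 := (integrableOn_exp_neg_mul_reducedBessel ν hs (α := β - 1) (by linarith)).const_mul β
  have i3 := integrableOn_exp_neg_mul_reducedBessel (ν + 1) hs (α := β + 1) (by linarith)
  have h := integral_deriv_exp_mul_rpow_mul_reducedBessel ν hs hβ ((i1.add i2).sub i3)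
    (fun x hx => (hasDerivAt_exp_mul_rpow_mul hx (hasDerivAt_reducedBessel ν x)).congr_deriv (by
      have hx : 0 < x := hx
      simp only [Pi.sub_apply, Pi.add_apply]
      rw [Real.rpow_add_one hx.ne']
      ring))
  rw [integral_sub' (i1.add i2) i3, integral_add' i1 i2, integral_const_mul,
    integral_const_mul] at h
  unfold besselLaplace
  linarith

lemma besselLaplace_eq_succ (ν : ℝ) {s α : ℝ} (hs : 0 < s) (hα : -1 < α) :
    besselLaplace ν α s = s * besselLaplace (ν + 1) (α + 1) s -
      (α - 2 * ν - 1) * besselLaplace (ν + 1) α s := by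
  have i1 := (integrableOn_exp_neg_mul_reducedBessel (ν + 1) hs (α := α + 1)
    (by linarith)).const_mul (-s)
  have i2 := (integrableOn_exp_neg_mul_reducedBessel (ν + 1) hs hα).const_mul (α - 2 * ν - 1)
  have i3 := integrableOn_exp_neg_mul_reducedBessel ν hs hα
  have h := integral_deriv_exp_mul_rpow_mul_reducedBessel (ν + 1) hs (β := α + 1) (by linarith)
    ((i1.add i2).add i3)
    (fun x hx => (hasDerivAt_exp_mul_rpow_mul hx
      (hasDerivAt_reducedBessel_succ ν (ne_of_gt hx))).congr_deriv (by
      have hx : 0 < x := hx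
      simp only [Pi.add_apply]
      rw [Real.rpow_add_one hx.ne', add_sub_cancel_right]
      field_simp
      ring))
  rw [integral_add' (i1.add i2) i3, integral_add' i1 i2, integral_const_mul,
    integral_const_mul] at h
  unfold besselLaplace
  linarith

lemma hasDerivAt_besselLaplace (ν : ℝ) {s α : ℝ} (hs : 0 < s) (hα : -1 < α) :
    HasDerivAt (besselLaplace ν α) (-besselLaplace ν (α + 1) s) s := by
  have hmeas : ∀ t : ℝ, AEStronglyMeasurable
      (fun x : ℝ => Real.exp (-t * x) * (x ^ α * reducedBessel ν x))
      (volume.restrict (Set.Ioi 0)) := by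
    intro t
    have h1 := (continuous_reducedBessel ν).measurable
    exact Measurable.aestronglyMeasurable (by fun_prop)
  have hmeas' : AEStronglyMeasurable
      (fun x : ℝ => -(Real.exp (-s * x) * (x ^ (α + 1) * reducedBessel ν x)))
      (volume.restrict (Set.Ioi 0)) := by
    have h1 := (continuous_reducedBessel ν).measurable
    exact Measurable.aestronglyMeasurable (by fun_prop)
  have h := (hasDerivAt_integral_of_dominated_loc_of_deriv_le
    (μ := volume.restrict (Set.Ioi (0 : ℝ)))
    (F := fun t x => Real.exp (-t * x) * (x ^ α * reducedBessel ν x))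
    (F' := fun t x => -(Real.exp (-t * x) * (x ^ (α + 1) * reducedBessel ν x)))
    (bound := fun x => ‖Real.exp (-(s / 2) * x) * (x ^ (α + 1) * reducedBessel ν x)‖)
    (x₀ := s) (Ioi_mem_nhds (by linarith : s / 2 < s))
    (Eventually.of_forall hmeas) (integrableOn_exp_neg_mul_reducedBessel ν hs hα) hmeas' ?_
    (integrableOn_exp_neg_mul_reducedBessel ν (half_pos hs) (by linarith)).norm ?_).2
  · rw [integral_neg] at h
    exact h
  · filter_upwards [ae_restrict_mem measurableSet_Ioi] with x hx t ht
    have hx : 0 < x := hx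
    have ht : s / 2 < t := ht
    rw [norm_neg, norm_mul, norm_mul _ (x ^ (α + 1) * _)]
    gcongr
    rw [Real.norm_eq_abs, Real.norm_eq_abs, Real.abs_exp, Real.abs_exp]
    gcongr
  · filter_upwards [ae_restrict_mem measurableSet_Ioi] with x hx t _
    have hx : 0 < x := hx
    have h1 : HasDerivAt (fun t : ℝ => Real.exp (-t * x)) (Real.exp (-t * x) * (-1 * x)) t :=
      ((hasDerivAt_id t).neg.mul_const x).exp
    refine (h1.mul_const _).congr_deriv ?_
    rw [Real.rpow_add_one hx.ne']
    ring

lemma besselLaplace_two_mul_succ {ν s : ℝ} (hν : -1 / 2 < ν) (hs : 0 < s) :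
    (1 + s ^ 2) * besselLaplace (ν + 1) (2 * (ν + 1)) s =
      (2 * ν + 1) * besselLaplace ν (2 * ν) s := by
  have h1 := besselLaplace_eq_succ ν hs (α := 2 * ν + 1) (by linarith)
  have h2 := besselLaplace_succ_succ ν hs (β := 2 * ν + 1) (by linarith)
  rw [show 2 * ν + 1 - 2 * ν - 1 = 0 by ring, zero_mul, sub_zero] at h1
  rw [add_sub_cancel_right] at h2
  rw [show 2 * (ν + 1) = 2 * ν + 1 + 1 by ring]
  rw [h1] at h2
  linear_combination h2

/-- The value at `s = 1` normalised so that `L[x^ν J_ν](s) = c (1 + s²)^{-ν-1/2}`. -/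
def besselLaplaceConst (ν : ℝ) : ℝ := besselLaplace ν (2 * ν) 1 * 2 ^ (ν + 1 / 2)

lemma besselLaplace_two_mul {ν s : ℝ} (hν : -1 / 2 < ν) (hs : 0 < s) :
    besselLaplace ν (2 * ν) s = besselLaplaceConst ν * (1 + s ^ 2) ^ (-(ν + 1 / 2)) := by
  set f : ℝ → ℝ := fun t => besselLaplace ν (2 * ν) t * (1 + t ^ 2) ^ (ν + 1 / 2) with hf
  have hd : ∀ t ∈ Set.Ioi (0 : ℝ), HasDerivAt f 0 t := by
    intro t ht
    have ht : 0 < t := ht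
    have hpos : 0 < 1 + t ^ 2 := by positivity
    have h1 := hasDerivAt_besselLaplace ν ht (α := 2 * ν) (by linarith)
    have h2 : HasDerivAt (fun t : ℝ => 1 + t ^ 2) (2 * t) t := by
      simpa using (hasDerivAt_pow 2 t).const_add 1
    refine (h1.mul (h2.rpow_const (p := ν + 1 / 2) (Or.inl hpos.ne'))).congr_deriv ?_
    have e1 := besselLaplace_eq_succ ν ht (α := 2 * ν + 1) (by linarith)
    rw [show 2 * ν + 1 - 2 * ν - 1 = 0 by ring, zero_mul, sub_zero,
      show 2 * ν + 1 + 1 = 2 * (ν + 1) by ring] at e1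
    have e2 := besselLaplace_two_mul_succ hν ht
    have e3 : (1 + t ^ 2) ^ (ν + 1 / 2) = (1 + t ^ 2) ^ (ν + 1 / 2 - 1) * (1 + t ^ 2) := by
      rw [← Real.rpow_add_one hpos.ne', sub_add_cancel]
    rw [e1, e3]
    linear_combination -(1 + t ^ 2) ^ (ν + 1 / 2 - 1) * t * e2
  have hconst : f s = f 1 := by
    refine isOpen_Ioi.is_const_of_deriv_eq_zero (convex_Ioi 0).isPreconnected
      (fun t ht => (hd t ht).differentiableAt.differentiableWithinAt)
      (fun t ht => (hd t ht).deriv) hs (Set.mem_Ioi.2 one_pos)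
  have hpos : 0 < 1 + s ^ 2 := by positivity
  simp only [hf] at hconst
  rw [one_pow, one_add_one_eq_two] at hconst
  rw [besselLaplaceConst, ← hconst, mul_assoc, ← Real.rpow_add hpos, add_neg_cancel,
    Real.rpow_zero, mul_one]

lemma tendsto_besselLaplace_two_mul {ν : ℝ} (hν : -1 / 2 < ν) :
    Tendsto (besselLaplace ν (2 * ν)) (nhdsWithin 0 (Set.Ioi 0))
      (nhds (besselLaplaceConst ν)) := by
  have hc : Tendsto (fun s : ℝ => besselLaplaceConst ν * (1 + s ^ 2) ^ (-(ν + 1 / 2)))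
      (nhdsWithin 0 (Set.Ioi 0)) (nhds (besselLaplaceConst ν)) := by
    have : ContinuousAt
        (fun s : ℝ => besselLaplaceConst ν * (1 + s ^ 2) ^ (-(ν + 1 / 2))) 0 := by
      refine ContinuousAt.mul continuousAt_const
        (ContinuousAt.rpow_const (by fun_prop) (Or.inl (by norm_num)))
    have := this.tendsto
    simp only [ne_eq, OfNat.ofNat_ne_zero, not_false_eq_true, zero_pow, add_zero,
      Real.one_rpow, mul_one] at this
    exact this.mono_left nhdsWithin_le_nhds
  refine hc.congr' ?_
  filter_upwards [self_mem_nhdsWithin] with s hs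
  exact (besselLaplace_two_mul hν hs).symm

lemma besselLaplaceConst_succ {ν : ℝ} (hν : -1 / 2 < ν) :
    besselLaplaceConst (ν + 1) = (2 * ν + 1) * besselLaplaceConst ν := by
  have h := besselLaplace_two_mul_succ hν one_pos
  unfold besselLaplaceConst
  rw [show ν + 1 + 1 / 2 = ν + 1 / 2 + 1 by ring, Real.rpow_add_one (by norm_num)]
  linear_combination 2 ^ (ν + 1 / 2) * h

lemma besselLaplace_eq_scaled (ν : ℝ) {α s : ℝ} (hs : 0 < s) :
    s ^ (α + 1) * besselLaplace ν α s =
      ∫ y in Set.Ioi (0 : ℝ), Real.exp (-1 * y) * y ^ α * reducedBessel ν (y / s) := by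
  have h := integral_comp_mul_left_Ioi
    (fun y : ℝ => Real.exp (-1 * y) * y ^ α * reducedBessel ν (y / s)) 0 hs
  rw [mul_zero, smul_eq_mul] at h
  have e : ∫ x in Set.Ioi (0 : ℝ), Real.exp (-1 * (s * x)) * (s * x) ^ α *
      reducedBessel ν (s * x / s) = s ^ α * besselLaplace ν α s := by
    rw [besselLaplace, ← integral_const_mul]
    refine setIntegral_congr_fun measurableSet_Ioi fun x hx => ?_
    have hx : 0 < x := hx
    rw [Real.mul_rpow hs.le hx.le, mul_div_cancel_left₀ _ hs.ne']
    ring_nf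
  rw [e] at h
  rw [Real.rpow_add_one hs.ne', mul_comm (s ^ α) s, mul_assoc, h, mul_inv_cancel_left₀ hs.ne']

lemma besselLaplaceConst_ne_zero {ν : ℝ} (hν : -1 / 2 < ν) : besselLaplaceConst ν ≠ 0 := by
  intro h0
  have hlim : Tendsto (fun s : ℝ => s ^ (2 * ν + 1) * besselLaplace ν (2 * ν) s) atTop
      (nhds (∫ y in Set.Ioi (0 : ℝ), Real.exp (-1 * y) * y ^ (2 * ν) * reducedBessel ν 0)) := by
    have hdom : Tendsto (fun s : ℝ => ∫ y in Set.Ioi (0 : ℝ),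
        Real.exp (-1 * y) * y ^ (2 * ν) * reducedBessel ν (y / s)) atTop
        (nhds (∫ y in Set.Ioi (0 : ℝ), Real.exp (-1 * y) * y ^ (2 * ν) * reducedBessel ν 0)) := by
      refine tendsto_integral_filter_of_dominated_convergence
        (fun y => Real.exp (-1 * y) * y ^ (2 * ν) * |reducedBessel ν 0|) ?_ ?_ ?_ ?_
      · refine Eventually.of_forall fun s => ?_
        have h1 := (continuous_reducedBessel ν).measurable
        exact Measurable.aestronglyMeasurable (by fun_prop)
      · filter_upwards [eventually_gt_atTop 0] with s hs
        filter_upwards [ae_restrict_mem measurableSet_Ioi] with y hy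
        have hy : 0 < y := hy
        rw [norm_mul, Real.norm_of_nonneg (by positivity : 0 ≤ Real.exp (-1 * y) * y ^ (2 * ν))]
        gcongr
        exact abs_reducedBessel_le hν.le (by positivity)
      · exact (integrableOn_exp_neg_mul_rpow one_pos (by linarith)).mul_const _
      · refine Eventually.of_forall fun y => ?_
        refine Tendsto.const_mul _ ?_
        exact ((continuous_reducedBessel ν).tendsto 0).comp
          (tendsto_const_nhds.div_atTop tendsto_id)
    refine hdom.congr' ?_
    filter_upwards [eventually_gt_atTop 0] with s hs
    exact (besselLaplace_eq_scaled ν hs).symm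
  have hzero : Tendsto (fun s : ℝ => s ^ (2 * ν + 1) * besselLaplace ν (2 * ν) s) atTop
      (nhds 0) := by
    refine tendsto_const_nhds.congr' ?_
    filter_upwards [eventually_gt_atTop 0] with s hs
    rw [besselLaplace_two_mul hν hs, h0]
    simp
  have heq := tendsto_nhds_unique hlim hzero
  rw [integral_mul_const] at heq
  have hG : ∫ y in Set.Ioi (0 : ℝ), Real.exp (-1 * y) * y ^ (2 * ν) = Real.Gamma (2 * ν + 1) := by
    rw [Real.Gamma_eq_integral (by linarith)]
    refine setIntegral_congr_fun measurableSet_Ioi fun x _ => ?_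
    simp
  rw [hG, reducedBessel_zero] at heq
  have h1 := Real.Gamma_pos_of_pos (by linarith : 0 < 2 * ν + 1)
  have h2 := Real.Gamma_pos_of_pos (by linarith : 0 < ν + 1)
  have h3 : (0 : ℝ) < 2 ^ (-ν) := by positivity
  have : 0 < Real.Gamma (2 * ν + 1) * ((Real.Gamma (ν + 1))⁻¹ * 2 ^ (-ν)) := by positivity
  linarith

/-- The Abel moment of `x^{ν + N} J_ν(x)`. -/
def besselMoment : ℕ → ℝ → ℝ
  | 0, ν => besselLaplaceConst ν
  | 1, _ => 0
  | N + 2, ν => -((N : ℝ) + 1) * besselMoment N (ν + 1)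

lemma tendsto_besselLaplace (N : ℕ) {ν : ℝ} (h : -1 < 2 * ν + N) :
    Tendsto (besselLaplace ν (2 * ν + N)) (nhdsWithin 0 (Set.Ioi 0))
      (nhds (besselMoment N ν)) := by
  have hid : Tendsto (fun s : ℝ => s) (nhdsWithin 0 (Set.Ioi 0)) (nhds 0) :=
    tendsto_id.mono_left nhdsWithin_le_nhds
  induction N using Nat.strong_induction_on generalizing ν with
  | _ N ih =>
  match N, ih, h with
  | 0, _, h =>
    simp only [Nat.cast_zero, add_zero] at h ⊢
    exact tendsto_besselLaplace_two_mul (by linarith)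
  | 1, _, h =>
    simp only [Nat.cast_one] at h ⊢
    have h1 := hid.mul (tendsto_besselLaplace_two_mul (ν := ν + 1) (by linarith))
    rw [zero_mul] at h1
    refine h1.congr' ?_
    filter_upwards [self_mem_nhdsWithin] with s hs
    rw [besselLaplace_eq_succ ν hs h, show 2 * ν + 1 + 1 = 2 * (ν + 1) by ring]
    ring
  | N + 2, ih, h =>
    push_cast at h ⊢
    have h1 := hid.mul (ih (N + 1) (by omega) (ν := ν + 1) (by push_cast; linarith))
    have h2 := (ih N (by omega) (ν := ν + 1) (by linarith)).const_mul ((N : ℝ) + 1)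
    have h3 := h1.sub h2
    rw [zero_mul, zero_sub, ← neg_mul] at h3
    refine h3.congr' ?_
    filter_upwards [self_mem_nhdsWithin] with s hs
    rw [besselLaplace_eq_succ ν hs h]
    push_cast
    rw [show 2 * (ν + 1) + ((N : ℝ) + 1) = 2 * ν + (N + 2) + 1 by ring,
      show 2 * (ν + 1) + (N : ℝ) = 2 * ν + (N + 2) by ring]
    ring

lemma besselMoment_odd (i : ℕ) (ν : ℝ) : besselMoment (2 * i + 1) ν = 0 := by
  induction i generalizing ν with
  | zero => rfl
  | succ i ih =>
    rw [show 2 * (i + 1) + 1 = 2 * i + 1 + 2 by ring, besselMoment, ih, mul_zero]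

lemma besselMoment_even_succ (i : ℕ) {ν : ℝ} (h : -1 < 2 * ν + 2 * i) :
    besselMoment (2 * (i + 1)) ν =
      -((2 * i + 1) * (2 * ν + 2 * i + 1)) * besselMoment (2 * i) ν := by
  induction i generalizing ν with
  | zero =>
    simp only [Nat.cast_zero, mul_zero, add_zero] at h
    rw [show 2 * (0 + 1) = 0 + 2 by ring, besselMoment]
    simp only [besselMoment]
    rw [besselLaplaceConst_succ (by linarith)]
    push_cast
    ring
  | succ i ih =>
    push_cast at h
    rw [show 2 * (i + 1 + 1) = 2 * (i + 1) + 2 by ring, besselMoment, ih (by linarith),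
      show 2 * (i + 1) = 2 * i + 2 by ring, besselMoment]
    push_cast
    ring

lemma besselMoment_even_ne_zero (i : ℕ) {ν : ℝ} (h : -1 < 2 * ν + 2 * i) :
    besselMoment (2 * i) ν ≠ 0 := by
  induction i generalizing ν with
  | zero =>
    simp only [Nat.cast_zero, mul_zero, add_zero] at h
    exact besselLaplaceConst_ne_zero (by linarith)
  | succ i ih =>
    push_cast at h
    rw [show 2 * (i + 1) = 2 * i + 2 by ring, besselMoment]
    exact mul_ne_zero (neg_ne_zero.2 (by positivity)) (ih (by linarith))

lemma integrableOn_cosh_mul_cosh_rpow {ν a : ℝ} (h : |ν| < a) :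
    IntegrableOn (fun u : ℝ => Real.cosh (ν * u) * Real.cosh u ^ (-a)) (Set.Ioi 0) := by
  have hb : IntegrableOn (fun u : ℝ => 2 ^ a * Real.exp ((|ν| - a) * u)) (Set.Ioi 0) :=
    (integrableOn_exp_mul_Ioi (by linarith) 0).const_mul _
  refine hb.mono' ?_ ?_
  · exact Measurable.aestronglyMeasurable (by fun_prop)
  · filter_upwards [ae_restrict_mem measurableSet_Ioi] with u hu
    have hu : 0 < u := hu
    have ha : 0 < a := (abs_nonneg ν).trans_lt h
    have h1 : Real.cosh (ν * u) ≤ Real.exp (|ν| * u) := by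
      rw [← Real.cosh_abs, abs_mul, abs_of_pos hu, Real.cosh_eq]
      have : Real.exp (-(|ν| * u)) ≤ Real.exp (|ν| * u) := by
        have : 0 ≤ |ν| * u := by positivity
        gcongr
        linarith
      linarith
    have h2 : Real.exp u / 2 ≤ Real.cosh u := by
      rw [Real.cosh_eq]
      have := Real.exp_pos (-u)
      linarith
    have h3 : Real.cosh u ^ (-a) ≤ (Real.exp u / 2) ^ (-a) :=
      Real.rpow_le_rpow_of_nonpos (by positivity) h2 (by linarith)
    have h4 : (Real.exp u / 2) ^ (-a) = 2 ^ a * Real.exp (-a * u) := by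
      rw [Real.div_rpow (by positivity) (by norm_num), ← Real.exp_mul, Real.rpow_neg (by norm_num),
        div_inv_eq_mul, mul_comm, mul_comm u]
    have hc := Real.cosh_pos (ν * u)
    have hc' := Real.rpow_pos_of_pos (Real.cosh_pos u) (-a)
    rw [Real.norm_of_nonneg (by positivity)]
    calc Real.cosh (ν * u) * Real.cosh u ^ (-a)
        ≤ Real.exp (|ν| * u) * (2 ^ a * Real.exp (-a * u)) := by
          rw [← h4]; gcongr
      _ = 2 ^ a * Real.exp ((|ν| - a) * u) := by
          rw [show (|ν| - a) * u = |ν| * u + -a * u by ring, Real.exp_add]; ring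

/-- The integral `∫₀^∞ cosh(νu) cosh(u)^{-a} du`. -/
def coshMoment (ν a : ℝ) : ℝ :=
  ∫ u in Set.Ioi (0 : ℝ), Real.cosh (ν * u) * Real.cosh u ^ (-a)

lemma coshMoment_pos {ν a : ℝ} (h : |ν| < a) : 0 < coshMoment ν a := by
  have hp : ∀ u : ℝ, 0 < Real.cosh (ν * u) * Real.cosh u ^ (-a) := fun u =>
    mul_pos (Real.cosh_pos _) (Real.rpow_pos_of_pos (Real.cosh_pos u) _)
  refine (setIntegral_pos_iff_support_of_nonneg_ae
    (Eventually.of_forall fun u => (hp u).le) (integrableOn_cosh_mul_cosh_rpow h)).2 ?_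
  have : Function.support (fun u : ℝ => Real.cosh (ν * u) * Real.cosh u ^ (-a)) = Set.univ :=
    Set.eq_univ_of_forall fun u => (hp u).ne'
  rw [this]
  simp

lemma coshMoment_add_two {ν a : ℝ} (h : |ν| < a) :
    a * (a + 1) * coshMoment ν (a + 2) = (a ^ 2 - ν ^ 2) * coshMoment ν a := by
  have ha : 0 < a := (abs_nonneg ν).trans_lt h
  set Φ : ℝ → ℝ := fun u => ν * Real.sinh (ν * u) * Real.cosh u ^ (-a) +
    a * Real.sinh u * Real.cosh (ν * u) * Real.cosh u ^ (-a - 1) with hΦ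
  have i1 := (integrableOn_cosh_mul_cosh_rpow h).const_mul (ν ^ 2 - a ^ 2)
  have i2 := (integrableOn_cosh_mul_cosh_rpow (ν := ν) (a := a + 2)
    (by linarith)).const_mul (a * (a + 1))
  have hd : ∀ u, HasDerivAt Φ (((fun u => (ν ^ 2 - a ^ 2) *
      (Real.cosh (ν * u) * Real.cosh u ^ (-a))) + fun u => a * (a + 1) *
      (Real.cosh (ν * u) * Real.cosh u ^ (-(a + 2)))) u) u := by
    intro u
    have hC := Real.cosh_pos u
    have d0 : HasDerivAt (fun u : ℝ => ν * u) ν u := by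
      simpa using (hasDerivAt_id u).const_mul ν
    have d1 := (d0.sinh.const_mul ν).mul
      ((Real.hasDerivAt_cosh u).rpow_const (p := -a) (Or.inl hC.ne'))
    have d2 := (((Real.hasDerivAt_sinh u).const_mul a).mul d0.cosh).mul
      ((Real.hasDerivAt_cosh u).rpow_const (p := -a - 1) (Or.inl hC.ne'))
    refine (d1.add d2).congr_deriv ?_
    have e1 : Real.cosh u ^ (-a - 1) = Real.cosh u ^ (-(a + 2)) * Real.cosh u := by
      rw [← Real.rpow_add_one hC.ne']; congr 1; ring
    have e2 : Real.cosh u ^ (-a) = Real.cosh u ^ (-(a + 2)) * Real.cosh u ^ 2 := by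
      rw [pow_two, ← mul_assoc, ← Real.rpow_add_one hC.ne', ← Real.rpow_add_one hC.ne']
      congr 1; ring
    simp only [Pi.mul_apply, Pi.add_apply]
    rw [show -a - 1 - 1 = -(a + 2) by ring, e1, e2]
    linear_combination (a * (-a - 1) * Real.cosh (ν * u) * Real.cosh u ^ (-(a + 2))) *
      Real.sinh_sq u
  have hΦint : IntegrableOn Φ (Set.Ioi 0) := by
    refine Integrable.mono' ((integrableOn_cosh_mul_cosh_rpow h).const_mul (|ν| + a))
      (Measurable.aestronglyMeasurable (by fun_prop)) (Eventually.of_forall fun u => ?_)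
    have hC := Real.cosh_pos u
    have hc := Real.cosh_pos (ν * u)
    have hsc : ∀ v : ℝ, |Real.sinh v| ≤ Real.cosh v := fun v =>
      abs_le.2 ⟨by have := Real.exp_pos v; rw [Real.sinh_eq, Real.cosh_eq]; linarith,
        (Real.sinh_lt_cosh v).le⟩
    have e1 : Real.cosh u ^ (-a) = Real.cosh u ^ (-a - 1) * Real.cosh u := by
      rw [← Real.rpow_add_one hC.ne', sub_add_cancel]
    have hp := Real.rpow_pos_of_pos hC (-a)
    have hp' := Real.rpow_pos_of_pos hC (-a - 1)
    refine (norm_add_le _ _).trans ?_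
    simp only [norm_mul, Real.norm_eq_abs, abs_of_pos hp, abs_of_pos hp', abs_of_pos hc,
      abs_of_pos ha]
    calc |ν| * |Real.sinh (ν * u)| * Real.cosh u ^ (-a) +
          a * |Real.sinh u| * Real.cosh (ν * u) * Real.cosh u ^ (-a - 1)
        ≤ |ν| * Real.cosh (ν * u) * Real.cosh u ^ (-a) +
          a * Real.cosh u * Real.cosh (ν * u) * Real.cosh u ^ (-a - 1) := by
          gcongr
          · exact hsc _
          · exact hsc _
      _ = (|ν| + a) * (Real.cosh (ν * u) * Real.cosh u ^ (-a)) := by rw [e1]; ring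
  have hintegral := integral_Ioi_of_hasDerivAt_of_tendsto (a := 0) (hd 0).continuousAt.continuousWithinAt
    (fun u _ => hd u) (i1.add i2)
    (tendsto_zero_of_hasDerivAt_of_integrableOn_Ioi (fun u _ => hd u) (i1.add i2) hΦint)
  rw [integral_add' i1 i2, integral_const_mul, integral_const_mul] at hintegral
  simp only [hΦ, mul_zero, Real.sinh_zero, zero_mul, add_zero, sub_zero] at hintegral
  unfold coshMoment
  linarith

/-- The integrand of the double integral for the moments of `x^{(μ-1)/2} K_ν(√x) / 2`. -/
def weightKernel (ν q x u : ℝ) : ℝ :=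
  (1 / 2) * x ^ q * (Real.exp (-Real.sqrt x * Real.cosh u) * Real.cosh (ν * u))

lemma weightKernel_pos (ν q : ℝ) {x : ℝ} (hx : 0 < x) (u : ℝ) : 0 < weightKernel ν q x u := by
  have := Real.cosh_pos (ν * u)
  unfold weightKernel
  positivity

lemma integral_weightKernel_left (ν u : ℝ) {q : ℝ} (hq : -1 < q) :
    IntegrableOn (fun x => weightKernel ν q x u) (Set.Ioi 0) ∧
    ∫ x in Set.Ioi (0 : ℝ), weightKernel ν q x u =
      Real.Gamma (2 * q + 2) * (Real.cosh (ν * u) * Real.cosh u ^ (-(2 * q + 2))) := by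
  have e : ∀ x : ℝ, weightKernel ν q x u =
      (1 / 2) * Real.cosh (ν * u) * (x ^ q * Real.exp (-Real.cosh u * x ^ (1 / 2 : ℝ))) := by
    intro x
    rw [weightKernel, Real.sqrt_eq_rpow,
      show -x ^ (1 / 2 : ℝ) * Real.cosh u = -Real.cosh u * x ^ (1 / 2 : ℝ) by ring]
    ring
  simp only [e]
  constructor
  · exact (integrableOn_rpow_mul_exp_neg_mul_rpow hq (by norm_num) (Real.cosh_pos u)).const_mul _
  · rw [integral_const_mul,
      integral_rpow_mul_exp_neg_mul_rpow (by norm_num) hq (Real.cosh_pos u),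
      show -(q + 1) / (1 / 2) = -(2 * q + 2) by ring, show (q + 1) / (1 / 2) = 2 * q + 2 by ring]
    ring

lemma integrable_weightKernel {ν q : ℝ} (h : |ν| < 2 * q + 2) :
    Integrable (Function.uncurry (weightKernel ν q))
      ((volume.restrict (Set.Ioi 0)).prod (volume.restrict (Set.Ioi 0))) := by
  have hq : -1 < q := by linarith [abs_nonneg ν]
  have hm : Measurable (Function.uncurry (weightKernel ν q)) := by
    unfold Function.uncurry weightKernel
    fun_prop
  rw [integrable_prod_iff' hm.aestronglyMeasurable]
  refine ⟨Eventually.of_forall fun u => (integral_weightKernel_left ν u hq).1, ?_⟩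
  refine ((integrableOn_cosh_mul_cosh_rpow h).const_mul (Real.Gamma (2 * q + 2))).congr
    (Eventually.of_forall fun u => ?_)
  simp only [Function.uncurry]
  rw [← (integral_weightKernel_left ν u hq).2]
  refine setIntegral_congr_fun measurableSet_Ioi fun x hx => ?_
  exact (Real.norm_of_nonneg (weightKernel_pos ν q hx u).le).symm

lemma weightW_mul_pow_eq {μ ν : ℝ} {m : ℕ} (hm : μ - ν = 2 * m) (i : ℕ) {x : ℝ} (hx : 0 < x) :
    weightW μ ν x * x ^ i =
      ∫ u in Set.Ioi (0 : ℝ), weightKernel ν ((μ - 1) / 2 + i) x u := by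
  rw [weightW, if_pos ⟨(m : ℤ), by exact_mod_cast hm⟩]
  simp only [weightKernel]
  rw [integral_const_mul, besselK, Real.rpow_add hx, Real.rpow_natCast]
  ring

lemma abs_lt_of_even_difference {μ ν : ℝ} (h1 : -1 < μ + ν) {m : ℕ} (hm : μ - ν = 2 * m) (i : ℕ) :
    |ν| < μ + 2 * i + 1 := by
  have hm0 : (0 : ℝ) ≤ m := m.cast_nonneg
  have hi0 : (0 : ℝ) ≤ i := i.cast_nonneg
  exact abs_lt.2 ⟨by linarith, by linarith⟩

lemma integrableOn_weightW_mul_pow {μ ν : ℝ} (h1 : -1 < μ + ν) {m : ℕ} (hm : μ - ν = 2 * m)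
    (i : ℕ) : IntegrableOn (fun x => weightW μ ν x * x ^ i) (Set.Ioi 0) := by
  have hk := integrable_weightKernel (ν := ν) (q := (μ - 1) / 2 + i)
    (by linarith [abs_lt_of_even_difference h1 hm i])
  refine IntegrableOn.congr_fun hk.integral_prod_left (fun x hx => ?_) measurableSet_Ioi
  exact (weightW_mul_pow_eq hm i hx).symm

lemma integral_weightW_mul_pow {μ ν : ℝ} (h1 : -1 < μ + ν) {m : ℕ} (hm : μ - ν = 2 * m)
    (i : ℕ) : ∫ x in Set.Ioi (0 : ℝ), weightW μ ν x * x ^ i =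
      Real.Gamma (μ + 2 * i + 1) * coshMoment ν (μ + 2 * i + 1) := by
  have ha := abs_lt_of_even_difference h1 hm i
  have hk := integrable_weightKernel (ν := ν) (q := (μ - 1) / 2 + i) (by linarith)
  have hq : -1 < (μ - 1) / 2 + i := by linarith [abs_nonneg ν]
  rw [setIntegral_congr_fun measurableSet_Ioi fun x hx => weightW_mul_pow_eq hm i hx,
    integral_integral_swap hk, coshMoment, ← integral_const_mul]
  refine integral_congr_ae (Eventually.of_forall fun u => ?_)
  simp only
  rw [(integral_weightKernel_left ν u hq).2,
    show 2 * ((μ - 1) / 2 + (i : ℝ)) + 2 = μ + 2 * i + 1 by ring]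

lemma integral_weightW_mul_pow_succ {μ ν : ℝ} (h1 : -1 < μ + ν) {m : ℕ} (hm : μ - ν = 2 * m)
    (i : ℕ) : ∫ x in Set.Ioi (0 : ℝ), weightW μ ν x * x ^ (i + 1) =
      ((2 * (m + i) + 1) * (2 * ν + 2 * (m + i) + 1)) *
        ∫ x in Set.Ioi (0 : ℝ), weightW μ ν x * x ^ i := by
  have ha := abs_lt_of_even_difference h1 hm i
  have hpos : 0 < μ + 2 * i + 1 := (abs_nonneg ν).trans_lt ha
  rw [integral_weightW_mul_pow h1 hm, integral_weightW_mul_pow h1 hm]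
  push_cast
  rw [show μ + 2 * ((i : ℝ) + 1) + 1 = μ + 2 * i + 1 + 1 + 1 by ring,
    Real.Gamma_add_one (by positivity), Real.Gamma_add_one (by positivity)]
  have h := coshMoment_add_two ha
  rw [show μ + 2 * (i : ℝ) + 1 + 2 = μ + 2 * i + 1 + 1 + 1 by ring] at h
  have hμ : μ = ν + 2 * m := by linarith
  rw [show (2 * ((m : ℝ) + i) + 1) * (2 * ν + 2 * (m + i) + 1) =
    (μ + 2 * i + 1) ^ 2 - ν ^ 2 by rw [hμ]; ring]
  linear_combination Real.Gamma (μ + 2 * i + 1) * h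

lemma ae_weightW_pos {μ ν : ℝ} (h1 : -1 < μ + ν) {m : ℕ} (hm : μ - ν = 2 * m) :
    ∀ᵐ x ∂volume.restrict (Set.Ioi (0 : ℝ)), 0 < weightW μ ν x := by
  have hk := integrable_weightKernel (ν := ν) (q := (μ - 1) / 2 + (0 : ℕ))
    (by have := abs_lt_of_even_difference h1 hm 0; push_cast at this ⊢; linarith)
  filter_upwards [hk.prod_right_ae, ae_restrict_mem measurableSet_Ioi] with x hx hx0
  have h := weightW_mul_pow_eq hm 0 hx0
  rw [pow_zero, mul_one] at h
  rw [h]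
  refine (setIntegral_pos_iff_support_of_nonneg_ae
    (Eventually.of_forall fun u => (weightKernel_pos _ _ hx0 u).le) hx).2 ?_
  have : Function.support (fun u : ℝ => weightKernel ν ((μ - 1) / 2 + (0 : ℕ)) x u) = Set.univ :=
    Set.eq_univ_of_forall fun u => (weightKernel_pos _ _ hx0 u).ne'
  rw [this]
  simp

/-- The Abel moments of `x^μ J_ν(x)` are proportional to the signed moments of `w_{μ,ν}`. -/
lemma exists_besselMoment_eq_weight_moment {μ ν : ℝ} (h1 : -1 < μ + ν) {m : ℕ}
    (hm : μ - ν = 2 * m) :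
    ∃ c : ℝ, c ≠ 0 ∧ ∀ i : ℕ, besselMoment (2 * (m + i)) ν =
      c * ((-1) ^ i * ∫ x in Set.Ioi (0 : ℝ), weightW μ ν x * x ^ i) := by
  have hbase : 0 < ∫ x in Set.Ioi (0 : ℝ), weightW μ ν x * x ^ 0 := by
    have ha := abs_lt_of_even_difference h1 hm 0
    rw [integral_weightW_mul_pow h1 hm]
    exact mul_pos (Real.Gamma_pos_of_pos ((abs_nonneg ν).trans_lt ha)) (coshMoment_pos ha)
  have hm' : ∀ i : ℕ, -1 < 2 * ν + 2 * ((m + i : ℕ) : ℝ) := by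
    intro i
    have hi0 : (0 : ℝ) ≤ i := i.cast_nonneg
    push_cast
    linarith
  refine ⟨besselMoment (2 * m) ν / ∫ x in Set.Ioi (0 : ℝ), weightW μ ν x * x ^ 0,
    div_ne_zero (besselMoment_even_ne_zero m (hm' 0)) hbase.ne', fun i => ?_⟩
  induction i with
  | zero =>
    rw [add_zero, pow_zero (-1 : ℝ), one_mul, div_mul_cancel₀ _ hbase.ne']
  | succ i ih =>
    rw [← add_assoc, besselMoment_even_succ (m + i) (hm' i), ih,
      integral_weightW_mul_pow_succ h1 hm]
    push_cast
    ring

lemma HasAbelLimit.congr {f g : ℝ → ℂ} {L : ℂ} (hf : HasAbelLimit f L)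
    (h : ∀ x, 0 < x → f x = g x) : HasAbelLimit g L := by
  have e : ∀ s : ℝ, Set.EqOn (fun x : ℝ => Complex.exp (-(s : ℂ) * (x : ℂ)) * f x)
      (fun x : ℝ => Complex.exp (-(s : ℂ) * (x : ℂ)) * g x) (Set.Ioi 0) := fun s x hx => by
    simp only [h x hx]
  refine ⟨fun s hs => (hf.1 s hs).congr_fun (e s) measurableSet_Ioi, ?_⟩
  simpa only [setIntegral_congr_fun measurableSet_Ioi (e _)] using hf.2

lemma HasAbelLimit.add {f g : ℝ → ℂ} {L M : ℂ} (hf : HasAbelLimit f L) (hg : HasAbelLimit g M) :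
    HasAbelLimit (fun x => f x + g x) (L + M) := by
  simp only [HasAbelLimit, mul_add]
  refine ⟨fun s hs => (hf.1 s hs).add (hg.1 s hs), (hf.2.add hg.2).congr' ?_⟩
  filter_upwards [self_mem_nhdsWithin] with s hs
  exact (integral_add (hf.1 s hs) (hg.1 s hs)).symm

lemma HasAbelLimit.const_mul {f : ℝ → ℂ} {L : ℂ} (a : ℂ) (hf : HasAbelLimit f L) :
    HasAbelLimit (fun x => a * f x) (a * L) := by
  simp only [HasAbelLimit, mul_left_comm _ a]
  refine ⟨fun s hs => (hf.1 s hs).const_mul a, ?_⟩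
  simp only [integral_const_mul]
  exact hf.2.const_mul a

lemma HasAbelLimit.unique {f : ℝ → ℂ} {L M : ℂ} (hf : HasAbelLimit f L)
    (hg : HasAbelLimit f M) : L = M :=
  tendsto_nhds_unique hf.2 hg.2

lemma hasAbelLimit_pow_mul_besselJ {μ ν : ℝ} (h1 : -1 < μ + ν) {m : ℕ} (hm : μ - ν = 2 * m)
    (j : ℕ) : HasAbelLimit (fun x : ℝ => (x : ℂ) ^ j * ((x ^ μ : ℝ) : ℂ) * (besselJ ν x : ℂ))
      (besselMoment (2 * m + j) ν : ℂ) := by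
  have hj0 : (0 : ℝ) ≤ j := j.cast_nonneg
  have hα : -1 < 2 * ν + ((2 * m + j : ℕ) : ℝ) := by push_cast; linarith
  have e : ∀ s : ℝ, Set.EqOn
      (fun x : ℝ => ((Real.exp (-s * x) *
        (x ^ (2 * ν + ((2 * m + j : ℕ) : ℝ)) * reducedBessel ν x) : ℝ) : ℂ))
      (fun x : ℝ => Complex.exp (-(s : ℂ) * (x : ℂ)) *
        ((x : ℂ) ^ j * ((x ^ μ : ℝ) : ℂ) * (besselJ ν x : ℂ))) (Set.Ioi 0) := by
    intro s x hx
    have hx : 0 < x := hx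
    have hp : x ^ (2 * ν + ((2 * m + j : ℕ) : ℝ)) = x ^ j * x ^ μ * x ^ ν := by
      rw [← Real.rpow_natCast x j, ← Real.rpow_add hx, ← Real.rpow_add hx]
      congr 1
      push_cast
      linarith
    simp only
    rw [hp, besselJ_eq_rpow_mul_reducedBessel ν hx]
    push_cast
    ring
  refine ⟨fun s hs => IntegrableOn.congr_fun
    (integrableOn_exp_neg_mul_reducedBessel ν hs hα).ofReal (e s) measurableSet_Ioi, ?_⟩
  simp only [← setIntegral_congr_fun measurableSet_Ioi (e _), integral_complex_ofReal]
  exact (Complex.continuous_ofReal.tendsto _).comp (tendsto_besselLaplace _ hα)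

/-- The symmetrisation `x ↦ (p(i√x) + p(-i√x)) / 2` of a polynomial. -/
def symmEval (p : Polynomial ℂ) (x : ℝ) : ℂ :=
  (p.eval (Complex.I * (Real.sqrt x : ℂ)) + p.eval (-(Complex.I * (Real.sqrt x : ℂ)))) / 2

lemma I_mul_sqrt_sq {x : ℝ} (hx : 0 ≤ x) : (Complex.I * (Real.sqrt x : ℂ)) ^ 2 = -(x : ℂ) := by
  rw [mul_pow, Complex.I_sq, ← Complex.ofReal_pow, Real.sq_sqrt hx]
  ring

lemma symmEval_add (p q : Polynomial ℂ) (x : ℝ) :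
    symmEval (p + q) x = symmEval p x + symmEval q x := by
  simp only [symmEval, eval_add]
  ring

lemma symmEval_monomial_even (i : ℕ) (a : ℂ) {x : ℝ} (hx : 0 ≤ x) :
    symmEval (monomial (2 * i) a) x = a * (-1) ^ i * (x : ℂ) ^ i := by
  simp only [symmEval, eval_monomial]
  rw [pow_mul, pow_mul, neg_sq, I_mul_sqrt_sq hx, neg_pow]
  ring

lemma symmEval_monomial_odd (i : ℕ) (a : ℂ) (x : ℝ) :
    symmEval (monomial (2 * i + 1) a) x = 0 := by
  simp only [symmEval, eval_monomial]
  rw [(odd_two_mul_add_one i).neg_pow]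
  ring

lemma integrableOn_weightW_mul_symmEval {μ ν : ℝ} (h1 : -1 < μ + ν) {m : ℕ}
    (hm : μ - ν = 2 * m) (p : Polynomial ℂ) :
    IntegrableOn (fun x => (weightW μ ν x : ℂ) * symmEval p x) (Set.Ioi 0) := by
  induction p using Polynomial.induction_on' with
  | add p q hp hq =>
    simp only [symmEval_add, mul_add]
    exact hp.add hq
  | monomial j a =>
    rcases Nat.even_or_odd' j with ⟨i, rfl | rfl⟩
    · have hi := (integrableOn_weightW_mul_pow h1 hm i).ofReal (𝕜 := ℂ)
      refine IntegrableOn.congr_fun (hi.const_mul (a * (-1) ^ i)) (fun x hx => ?_)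
        measurableSet_Ioi
      simp only [symmEval_monomial_even i a (le_of_lt hx)]
      simp only [Complex.coe_algebraMap, RCLike.ofReal_mul, RCLike.ofReal_pow]
      ring
    · simp only [symmEval_monomial_odd, mul_zero]
      exact integrableOn_zero

/-- The Abel functional of `x^μ J_ν(x)` on polynomials, expressed through the weight `w_{μ,ν}`. -/
lemma exists_hasAbelLimit_polynomial {μ ν : ℝ} (h1 : -1 < μ + ν) {m : ℕ}
    (hm : μ - ν = 2 * m) :
    ∃ c : ℂ, c ≠ 0 ∧ ∀ p : Polynomial ℂ,
      HasAbelLimit (fun x : ℝ => p.eval (x : ℂ) * ((x ^ μ : ℝ) : ℂ) * (besselJ ν x : ℂ))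
        (c * ∫ x in Set.Ioi (0 : ℝ), (weightW μ ν x : ℂ) * symmEval p x) := by
  obtain ⟨c, hc, hmom⟩ := exists_besselMoment_eq_weight_moment h1 hm
  refine ⟨(c : ℂ), by exact_mod_cast hc, fun p => ?_⟩
  induction p using Polynomial.induction_on' with
  | add p q hp hq =>
    simp only [symmEval_add, mul_add, eval_add, add_mul]
    rw [integral_add (integrableOn_weightW_mul_symmEval h1 hm p)
      (integrableOn_weightW_mul_symmEval h1 hm q), mul_add]
    exact hp.add hq
  | monomial j a =>
    have h := (hasAbelLimit_pow_mul_besselJ h1 hm j).const_mul a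
    have e : a * (besselMoment (2 * m + j) ν : ℂ) =
        c * ∫ x in Set.Ioi (0 : ℝ), (weightW μ ν x : ℂ) * symmEval (monomial j a) x := by
      rcases Nat.even_or_odd' j with ⟨i, rfl | rfl⟩
      · have hi : ∫ x in Set.Ioi (0 : ℝ), (weightW μ ν x : ℂ) * symmEval (monomial (2 * i) a) x =
            a * (-1) ^ i * ((∫ x in Set.Ioi (0 : ℝ), weightW μ ν x * x ^ i : ℝ) : ℂ) := by
          rw [← integral_complex_ofReal, ← integral_const_mul]
          refine setIntegral_congr_fun measurableSet_Ioi fun x hx => ?_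
          simp only [symmEval_monomial_even i a (le_of_lt hx)]
          push_cast
          ring
        rw [hi, ← mul_add, hmom]
        push_cast
        ring
      · rw [← add_assoc, ← mul_add, besselMoment_odd]
        simp [symmEval_monomial_odd]
    rw [← e]
    exact h.congr fun x _ => by rw [eval_monomial]; ring

lemma monicOrthoBessel_iff {μ ν : ℝ} (h1 : -1 < μ + ν) {m : ℕ} (hm : μ - ν = 2 * m) (d : ℕ)
    (P : Polynomial ℂ) : MonicOrthoBessel μ ν d P ↔ P.Monic ∧ P.natDegree = d ∧
      ∀ k < d, ∫ x in Set.Ioi (0 : ℝ), (weightW μ ν x : ℂ) * symmEval (P * X ^ k) x = 0 := by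
  obtain ⟨c, hc, hL⟩ := exists_hasAbelLimit_polynomial h1 hm
  have e : ∀ (k : ℕ) (x : ℝ), 0 < x →
      (P * X ^ k).eval (x : ℂ) * ((x ^ μ : ℝ) : ℂ) * (besselJ ν x : ℂ) =
      P.eval (x : ℂ) * ((x ^ ((k : ℝ) + μ) : ℝ) : ℂ) * (besselJ ν x : ℂ) := by
    intro k x hx
    rw [Real.rpow_add hx, Real.rpow_natCast, eval_mul, eval_pow, eval_X]
    push_cast
    ring
  refine and_congr_right fun _ => and_congr_right fun _ => forall₂_congr fun k _ => ?_
  have hk := (hL (P * X ^ k)).congr (e k)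
  constructor
  · intro h
    exact (mul_eq_zero.1 (hk.unique h)).resolve_left hc
  · intro h
    rwa [h, mul_zero] at hk

lemma integral_symmEval_mul_eq_zero {μ ν : ℝ} (h1 : -1 < μ + ν) {m : ℕ} (hm : μ - ν = 2 * m)
    {d : ℕ} {D : Polynomial ℂ}
    (hD : ∀ k < d, ∫ x in Set.Ioi (0 : ℝ), (weightW μ ν x : ℂ) * symmEval (D * X ^ k) x = 0)
    {q : Polynomial ℂ} (hq : q.natDegree < d) :
    ∫ x in Set.Ioi (0 : ℝ), (weightW μ ν x : ℂ) * symmEval (D * q) x = 0 := by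
  have e : ∀ x, (weightW μ ν x : ℂ) * symmEval (D * q) x = ∑ k ∈ Finset.range d,
      q.coeff k * ((weightW μ ν x : ℂ) * symmEval (D * X ^ k) x) := by
    intro x
    simp only [symmEval, eval_mul, eval_pow, eval_X]
    rw [eval_eq_sum_range' hq, eval_eq_sum_range' hq, Finset.mul_sum, Finset.mul_sum,
      ← Finset.sum_add_distrib, Finset.sum_div, Finset.mul_sum]
    exact Finset.sum_congr rfl fun k _ => by ring
  simp only [e]
  rw [integral_finsetSum _ fun k _ =>
    (integrableOn_weightW_mul_symmEval h1 hm (D * X ^ k)).const_mul _]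
  refine Finset.sum_eq_zero fun k hk => ?_
  rw [integral_const_mul, hD k (Finset.mem_range.1 hk), mul_zero]

/-- Nondegeneracy of the Abel functional on polynomials of degree less than `d`. -/
lemma eq_zero_of_orthogonal {μ ν : ℝ} (h1 : -1 < μ + ν) {m : ℕ} (hm : μ - ν = 2 * m)
    {d : ℕ} {D : Polynomial ℂ} (hdeg : D.natDegree < d)
    (hD : ∀ k < d, ∫ x in Set.Ioi (0 : ℝ), (weightW μ ν x : ℂ) * symmEval (D * X ^ k) x = 0) :
    D = 0 := by
  set q : Polynomial ℂ := (D.map (starRingEnd ℂ)).comp (-X) with hq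
  have hqdeg : q.natDegree < d := by
    rw [hq, natDegree_comp, natDegree_neg, natDegree_X, mul_one]
    exact natDegree_map_le.trans_lt hdeg
  have hqeval : ∀ z : ℂ, (starRingEnd ℂ) z = -z → D.eval z * q.eval z = (‖D.eval z‖ ^ 2 : ℝ) := by
    intro z hz
    have : q.eval z = (starRingEnd ℂ) (D.eval z) := by
      rw [hq, eval_comp, eval_neg, eval_X, ← hz, eval_map, eval₂_hom]
    rw [this, Complex.mul_conj, Complex.normSq_eq_norm_sq]
  set F : ℝ → ℝ := fun x => (‖D.eval (Complex.I * (Real.sqrt x : ℂ))‖ ^ 2 +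
    ‖D.eval (-(Complex.I * (Real.sqrt x : ℂ)))‖ ^ 2) / 2 with hF
  have hsymm : ∀ x, (weightW μ ν x : ℂ) * symmEval (D * q) x = ((weightW μ ν x * F x : ℝ) : ℂ) := by
    intro x
    rw [symmEval, eval_mul, eval_mul, hqeval _ (by simp), hqeval _ (by simp), hF]
    push_cast
    ring
  have hzero := integral_symmEval_mul_eq_zero h1 hm hD hqdeg
  have hintegral := integrableOn_weightW_mul_symmEval h1 hm (D * q)
  simp only [hsymm] at hzero hintegral
  rw [integral_complex_ofReal, Complex.ofReal_eq_zero] at hzero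
  have hintegral' : IntegrableOn (fun x => weightW μ ν x * F x) (Set.Ioi 0) := by
    have h : Integrable (fun x => weightW μ ν x * F x) (volume.restrict (Set.Ioi 0)) := by
      simpa using hintegral.re
    exact h
  have hwpos := ae_weightW_pos h1 hm
  have hFnonneg : ∀ x, 0 ≤ F x := fun x => by simp only [hF]; positivity
  have hae := (integral_eq_zero_iff_of_nonneg_ae
    (by filter_upwards [hwpos] with x hx using mul_nonneg hx.le (hFnonneg x)) hintegral').1 hzero
  have hroot : ∀ᵐ x ∂volume.restrict (Set.Ioi (0 : ℝ)),
      D.eval (Complex.I * (Real.sqrt x : ℂ)) = 0 := by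
    filter_upwards [hae, hwpos] with x hx hw
    have hFx : F x = 0 := (mul_eq_zero.1 hx).resolve_left hw.ne'
    simp only [hF] at hFx
    have h2 : ‖D.eval (Complex.I * (Real.sqrt x : ℂ))‖ ^ 2 = 0 := by
      nlinarith [sq_nonneg ‖D.eval (Complex.I * (Real.sqrt x : ℂ))‖,
        sq_nonneg ‖D.eval (-(Complex.I * (Real.sqrt x : ℂ)))‖]
    exact norm_eq_zero.1 (pow_eq_zero_iff two_ne_zero |>.1 h2)
  by_contra hne
  have hfin : {x : ℝ | x ∈ Set.Ioi (0 : ℝ) ∧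
      D.eval (Complex.I * (Real.sqrt x : ℂ)) = 0}.Finite := by
    refine Set.Finite.of_finite_image
      ((D.roots.toFinset.finite_toSet).subset ?_) (f := fun x : ℝ => Complex.I * (Real.sqrt x : ℂ)) ?_
    · rintro _ ⟨x, hx, rfl⟩
      simpa [hne] using hx.2
    · intro x hx y hy hxy
      have h : Real.sqrt x = Real.sqrt y := by
        have := mul_left_cancel₀ Complex.I_ne_zero hxy
        exact_mod_cast this
      exact (Real.sqrt_inj (le_of_lt hx.1) (le_of_lt hy.1)).1 h
  rw [ae_restrict_iff' measurableSet_Ioi] at hroot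
  have hvol : volume (Set.Ioi (0 : ℝ)) ≤ 0 := by
    have hnull := hfin.measure_zero volume
    have hsub : Set.Ioi (0 : ℝ) ⊆ {x : ℝ | x ∈ Set.Ioi (0 : ℝ) ∧
        D.eval (Complex.I * (Real.sqrt x : ℂ)) = 0} ∪
        {x : ℝ | ¬(x ∈ Set.Ioi (0 : ℝ) → D.eval (Complex.I * (Real.sqrt x : ℂ)) = 0)} := by
      intro x hx
      by_cases h : D.eval (Complex.I * (Real.sqrt x : ℂ)) = 0
      · exact Or.inl ⟨hx, h⟩
      · exact Or.inr fun h' => h (h' hx)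
    refine (measure_mono hsub).trans ((measure_union_le _ _).trans ?_)
    rw [hnull, ae_iff.1 hroot, add_zero]
  simp at hvol

lemma monic_neg_one_pow_mul_comp_neg_X_sq {n : ℕ} {φ : Polynomial ℝ} (hmon : φ.Monic)
    (hdeg : φ.natDegree = n) :
    (C ((-1 : ℂ) ^ n) * ((φ.map (algebraMap ℝ ℂ)).comp (-(X ^ 2)))).Monic ∧
    (C ((-1 : ℂ) ^ n) * ((φ.map (algebraMap ℝ ℂ)).comp (-(X ^ 2)))).natDegree = 2 * n := by
  have hX : (-(X ^ 2 : Polynomial ℂ)).natDegree = 2 := by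
    rw [natDegree_neg, natDegree_X_pow]
  have hdeg' : (φ.map (algebraMap ℝ ℂ)).natDegree = n := by rw [hmon.natDegree_map, hdeg]
  constructor
  · rw [Monic, leadingCoeff_mul, leadingCoeff_C, leadingCoeff_comp (by rw [hX]; norm_num),
      (hmon.map _).leadingCoeff, hdeg', leadingCoeff_neg, leadingCoeff_X_pow, one_mul,
      ← mul_pow]
    norm_num
  · rw [natDegree_C_mul (pow_ne_zero _ (by norm_num)), natDegree_comp, hX, hdeg', mul_comm]

lemma symmEval_comp_neg_X_sq_mul_X_pow (φ : Polynomial ℝ) (a : ℂ) (k : ℕ) {x : ℝ} (hx : 0 ≤ x) :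
    symmEval (C a * ((φ.map (algebraMap ℝ ℂ)).comp (-(X ^ 2))) * X ^ k) x =
      ((φ.eval x : ℝ) : ℂ) * symmEval (monomial k a) x := by
  have e : ∀ z : ℂ, z ^ 2 = -(x : ℂ) →
      (C a * ((φ.map (algebraMap ℝ ℂ)).comp (-(X ^ 2))) * X ^ k).eval z =
        ((φ.eval x : ℝ) : ℂ) * (monomial k a).eval z := by
    intro z hz
    have h : (φ.map (algebraMap ℝ ℂ)).eval (x : ℂ) = ((φ.eval x : ℝ) : ℂ) := by
      rw [eval_map]
      exact eval₂_at_apply (algebraMap ℝ ℂ) x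
    simp only [eval_mul, eval_C, eval_comp, eval_neg, eval_pow, eval_X, eval_monomial, hz,
      neg_neg, h]
    ring
  rw [symmEval, symmEval, e _ (I_mul_sqrt_sq hx), e _ (by rw [neg_sq, I_mul_sqrt_sq hx])]
  ring

/-- even-degree orthogonal polynomials for `x^μ J_ν(x)`, `μ - ν` even. -/
theorem ortho_even_degree_even_case (μ ν : ℝ) (h1 : -1 < μ + ν)
    (heven : ∃ m : ℕ, μ - ν = 2 * m) (n : ℕ) (φ : Polynomial ℝ)
    (hφ : IsMonicOrthoW μ ν n φ) :
    MonicOrthoBessel μ ν (2 * n)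
      (Polynomial.C ((-1 : ℂ) ^ n) * ((φ.map (algebraMap ℝ ℂ)).comp (-(Polynomial.X ^ 2)))) ∧
    ∀ Q : Polynomial ℂ, MonicOrthoBessel μ ν (2 * n) Q →
      Q = Polynomial.C ((-1 : ℂ) ^ n) *
            ((φ.map (algebraMap ℝ ℂ)).comp (-(Polynomial.X ^ 2))) := by
  obtain ⟨m, hm⟩ := heven
  obtain ⟨hmon, hdeg, horth⟩ := hφ
  obtain ⟨hPmon, hPdeg⟩ := monic_neg_one_pow_mul_comp_neg_X_sq hmon hdeg
  have hPorth : ∀ k < 2 * n, ∫ x in Set.Ioi (0 : ℝ), (weightW μ ν x : ℂ) *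
      symmEval (C ((-1 : ℂ) ^ n) * ((φ.map (algebraMap ℝ ℂ)).comp (-(X ^ 2))) * X ^ k) x = 0 := by
    intro k hk
    rcases Nat.even_or_odd' k with ⟨i, rfl | rfl⟩
    · have h := horth i (by omega)
      have e : Set.EqOn (fun x : ℝ => (weightW μ ν x : ℂ) *
          symmEval (C ((-1 : ℂ) ^ n) * ((φ.map (algebraMap ℝ ℂ)).comp (-(X ^ 2))) *
            X ^ (2 * i)) x)
          (fun x : ℝ => (-1 : ℂ) ^ n * (-1) ^ i *
            ((weightW μ ν x * φ.eval x * x ^ i : ℝ) : ℂ)) (Set.Ioi 0) := by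
        intro x hx
        have hx : (0 : ℝ) ≤ x := le_of_lt hx
        simp only
        rw [symmEval_comp_neg_X_sq_mul_X_pow φ _ _ hx, symmEval_monomial_even i _ hx]
        push_cast
        ring
      rw [setIntegral_congr_fun measurableSet_Ioi e, integral_const_mul,
        integral_complex_ofReal, h, Complex.ofReal_zero, mul_zero]
    · refine setIntegral_eq_zero_of_forall_eq_zero fun x hx => ?_
      rw [symmEval_comp_neg_X_sq_mul_X_pow φ _ _ (le_of_lt hx), symmEval_monomial_odd, mul_zero,
        mul_zero]
  refine ⟨(monicOrthoBessel_iff h1 hm _ _).2 ⟨hPmon, hPdeg, hPorth⟩, fun Q hQ => ?_⟩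
  obtain ⟨hQmon, hQdeg, hQorth⟩ := (monicOrthoBessel_iff h1 hm _ _).1 hQ
  set P := C ((-1 : ℂ) ^ n) * ((φ.map (algebraMap ℝ ℂ)).comp (-(X ^ 2))) with hP
  rcases Nat.eq_zero_or_pos n with hn | hn
  · rw [hQmon.natDegree_eq_zero.1 (by omega), hPmon.natDegree_eq_zero.1 (by omega)]
  rw [← sub_eq_zero]
  refine eq_zero_of_orthogonal h1 hm (d := 2 * n) ?_ fun k hk => ?_
  · by_cases hQP : Q - P = 0
    · rw [hQP, natDegree_zero]
      omega
    · have hdegQP : Q.degree = P.degree := by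
        rw [degree_eq_natDegree hQmon.ne_zero, degree_eq_natDegree hPmon.ne_zero, hQdeg, hPdeg]
      have hlt := degree_sub_lt_left hdegQP hQmon.ne_zero
        (hQmon.leadingCoeff.trans hPmon.leadingCoeff.symm)
      rw [degree_eq_natDegree hQP, degree_eq_natDegree hQmon.ne_zero, hQdeg] at hlt
      exact_mod_cast hlt
  · have e : ∀ x, (weightW μ ν x : ℂ) * symmEval ((Q - P) * X ^ k) x =
        (weightW μ ν x : ℂ) * symmEval (Q * X ^ k) x -
        (weightW μ ν x : ℂ) * symmEval (P * X ^ k) x := by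
      intro x
      simp only [symmEval, eval_mul, eval_sub]
      ring
    simp only [e]
    rw [integral_sub (integrableOn_weightW_mul_symmEval h1 hm _)
      (integrableOn_weightW_mul_symmEval h1 hm _), hQorth k hk, hPorth k hk, sub_zero]

end
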